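/- Let G be a simple graph and let a₁, a₂, a₃, a₄ be four distinct pairwise non-adjacent vertices of G, each having exactly 3 neighbors, such that any two distinct vertices among a₁, a₂, a₃, a₄ have at most one common neighbor on which both are incident, and such that every other vertex of G has at most 2 neighbors in A = {a₁, a₂, a₃, a₄}. Call a vertex outside A 'type 1' if it has exactly one neighbor in A and 'type 2' if it has exactly two. Then it is impossible that simultaneously: all three neighbors of a₁ are type 1, exactly one neighbor of a₂ is type 1 (its other two neighbors being type 2), and every neighbor of a₃ and every neighbor of a₄ is type 2. -/

import Mathlib

/-- Subcase "3, 1, 0, 0": let `a₁, a₂, a₃, a₄` be four distinct pairwise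
non-adjacent vertices of a simple graph, each of degree exactly 3, any two of
which have at most one common neighbor, and such that every other vertex has at
most 2 neighbors in `A = {a₁, a₂, a₃, a₄}`.  Calling a vertex outside `A`
"type 1" (resp. "type 2") if it has exactly one (resp. exactly two) neighbors in
`A`, it is impossible that simultaneously all three neighbors of `a₁` are
type 1, exactly one neighbor of `a₂` is type 1 with its other two neighbors
type 2, and every neighbor of `a₃` and of `a₄` is type 2. -/
theorem subcase_3100_impossible {V : Type*} [Fintype V] [DecidableEq V]
    (G : SimpleGraph V) [DecidableRel G.Adj] (a₁ a₂ a₃ a₄ : V)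
    (hcard : ({a₁, a₂, a₃, a₄} : Finset V).card = 4)
    (hnonadj : ∀ a ∈ ({a₁, a₂, a₃, a₄} : Finset V),
      ∀ b ∈ ({a₁, a₂, a₃, a₄} : Finset V), ¬ G.Adj a b)
    (hdeg : ∀ a ∈ ({a₁, a₂, a₃, a₄} : Finset V), G.degree a = 3)
    (hcommon : ∀ a ∈ ({a₁, a₂, a₃, a₄} : Finset V),
      ∀ b ∈ ({a₁, a₂, a₃, a₄} : Finset V), a ≠ b →
        (Finset.univ.filter (fun v => G.Adj a v ∧ G.Adj b v)).card ≤ 1)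
    (htype : ∀ v, v ∉ ({a₁, a₂, a₃, a₄} : Finset V) →
      (({a₁, a₂, a₃, a₄} : Finset V).filter (fun a => G.Adj v a)).card ≤ 2) :
    ¬ ((∀ v ∈ G.neighborFinset a₁,
          (({a₁, a₂, a₃, a₄} : Finset V).filter (fun a => G.Adj v a)).card = 1) ∧
       ((G.neighborFinset a₂).filter
          (fun v => (({a₁, a₂, a₃, a₄} : Finset V).filter
            (fun a => G.Adj v a)).card = 1)).card = 1 ∧
       ((G.neighborFinset a₂).filter
          (fun v => (({a₁, a₂, a₃, a₄} : Finset V).filter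
            (fun a => G.Adj v a)).card = 2)).card = 2 ∧
       (∀ v ∈ G.neighborFinset a₃,
          (({a₁, a₂, a₃, a₄} : Finset V).filter (fun a => G.Adj v a)).card = 2) ∧
       (∀ v ∈ G.neighborFinset a₄,
          (({a₁, a₂, a₃, a₄} : Finset V).filter (fun a => G.Adj v a)).card = 2)) := by
  rintro ⟨h1, -, -, h3, -⟩
  have hne : a₃ ≠ a₂ ∧ a₃ ≠ a₄ := by
    constructor
    · rintro rfl
      have := Finset.card_le_three (a := a₁) (b := a₃) (c := a₄)
      simp at hcard
      omega
    · rintro rfl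
      have := Finset.card_le_three (a := a₁) (b := a₂) (c := a₃)
      simp at hcard
      omega
  have c2 := hcommon a₃ (by simp) a₂ (by simp) hne.1
  have c4 := hcommon a₃ (by simp) a₄ (by simp) hne.2
  have hd := hdeg a₃ (by simp)
  rw [← SimpleGraph.card_neighborFinset_eq_degree] at hd
  have hsub : G.neighborFinset a₃ ⊆
      (Finset.univ.filter (fun v => G.Adj a₃ v ∧ G.Adj a₂ v)) ∪
      (Finset.univ.filter (fun v => G.Adj a₃ v ∧ G.Adj a₄ v)) := by
    intro v hv
    have hv2 := h3 v hv
    have hv3 : G.Adj a₃ v := by simpa using hv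
    by_contra hcon
    simp only [Finset.mem_union, Finset.mem_filter, Finset.mem_univ, true_and, hv3, not_or] at hcon
    have hn1 : ¬ G.Adj a₁ v := by
      intro h
      have := h1 v (by simpa using h)
      omega
    have hs : (({a₁, a₂, a₃, a₄} : Finset V).filter (fun a => G.Adj v a)) ⊆ {a₃} := by
      intro x hx
      simp only [Finset.mem_filter, Finset.mem_insert, Finset.mem_singleton] at hx ⊢
      obtain ⟨rfl | rfl | rfl | rfl, hx⟩ := hx
      · exact absurd hx.symm hn1
      · exact absurd hx.symm hcon.1
      · rfl
      · exact absurd hx.symm hcon.2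
    have := Finset.card_le_card hs
    simp only [Finset.card_singleton] at this
    omega
  have h5 := Finset.card_le_card hsub
  have h6 := Finset.card_union_le
      (Finset.univ.filter (fun v => G.Adj a₃ v ∧ G.Adj a₂ v))
      (Finset.univ.filter (fun v => G.Adj a₃ v ∧ G.Adj a₄ v))
  omega
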